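/- There is no 12×12 symmetric negative-definite integer matrix m with all diagonal entries equal to −2 such that the cokernel ℤ¹²/mℤ¹² is isomorphic to (ℤ/2ℤ)¹¹. -/

import Mathlib

/-- There is no 12×12 symmetric negative-definite integer matrix with all diagonal
entries `−2` whose discriminant group `ℤ¹²/mℤ¹²` is isomorphic to `(ℤ/2ℤ)¹¹`. -/
theorem no_rank12_root_lattice_with_disc_Z2_11 :
    ¬ ∃ m : Matrix (Fin 12) (Fin 12) ℤ,
      m.IsSymm ∧ (∀ i, m i i = -2) ∧
      (-(m.map ((↑·) : ℤ → ℝ))).PosDef ∧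
      Nonempty (((Fin 12 → ℤ) ⧸ LinearMap.range (Matrix.mulVecLin m)) ≃+
        (Fin 11 → ZMod 2)) := by
  rintro ⟨m, hsymm, hdiag, -, ⟨e⟩⟩
  -- the composite surjection and its kernel
  let g : (Fin 12 → ℤ) →+ (Fin 11 → ZMod 2) :=
    e.toAddMonoidHom.comp (LinearMap.range (Matrix.mulVecLin m)).mkQ.toAddMonoidHom
  have hgs : Function.Surjective g := by
    intro y
    obtain ⟨x, hx⟩ := Submodule.mkQ_surjective _ (e.symm y)
    refine ⟨x, ?_⟩
    change e ((LinearMap.range (Matrix.mulVecLin m)).mkQ x) = y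
    rw [hx]; simp
  have hgk : ∀ x, g x = 0 ↔ ∃ y, m.mulVec y = x := by
    intro x
    change e ((LinearMap.range (Matrix.mulVecLin m)).mkQ x) = 0 ↔ _
    rw [EmbeddingLike.map_eq_zero_iff, Submodule.mkQ_apply, Submodule.Quotient.mk_eq_zero]
    simp [LinearMap.mem_range]
  -- reduction mod 2
  let G : (Fin 12 → ZMod 2) →ₗ[ZMod 2] (Fin 11 → ZMod 2) :=
    Fintype.linearCombination (ZMod 2) (fun k => g (Pi.single k 1))
  have hG : ∀ x : Fin 12 → ℤ, G (fun k => (x k : ZMod 2)) = g x := by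
    intro x
    have hx : x = ∑ k, x k • (Pi.single k 1 : Fin 12 → ℤ) := by
      ext i; simp [Finset.sum_apply, Pi.single_apply]
    conv_rhs => rw [hx]
    rw [map_sum]
    simp only [G, Fintype.linearCombination_apply]
    refine Finset.sum_congr rfl fun k _ => ?_
    rw [map_zsmul, Int.cast_smul_eq_zsmul]
  have hGs : Function.Surjective G := fun y => by
    obtain ⟨x, hx⟩ := hgs y
    exact ⟨_, (hG x).trans hx⟩
  have hker : Module.finrank (ZMod 2) (LinearMap.ker G) = 1 := by
    have h := G.finrank_range_add_finrank_ker
    rw [LinearMap.range_eq_top.2 hGs] at h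
    simp at h
    omega
  obtain ⟨w, hw0, hw⟩ := finrank_eq_one_iff'.1 hker
  -- the columns of `m` are multiples of `w` modulo 2
  have hcol : ∀ j, ∃ c : ZMod 2, ∀ i, (m i j : ZMod 2) = c * w.1 i := by
    intro j
    have hj : g (fun i => m i j) = 0 := (hgk _).2 ⟨Pi.single j 1, by ext i; simp⟩
    obtain ⟨c, hc⟩ := hw ⟨fun i => (m i j : ZMod 2), by
      rw [LinearMap.mem_ker, hG]; exact hj⟩
    refine ⟨c, fun i => ?_⟩
    have := congrFun (congrArg Subtype.val hc) i
    simpa using this.symm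
  choose c hc using hcol
  have hd : ∀ i, c i * w.1 i = 0 := by
    intro i
    rw [← hc, hdiag]; decide
  have hm : ∀ i j, (m i j : ZMod 2) = 0 := by
    intro i j
    have h2 : (m i j : ZMod 2) * (m i j : ZMod 2) = 0 := by
      nth_rewrite 2 [← hsymm.apply i j]
      rw [hc, hc]
      linear_combination (c i * w.1 i) * hd j
    exact mul_self_eq_zero.1 h2
  -- hence the kernel is zero, a contradiction
  apply hw0
  choose x hx using fun k => ZMod.intCast_surjective (w.1 k)
  have hxg : g x = 0 := by
    rw [← hG, funext hx]; exact w.2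
  obtain ⟨y, hy⟩ := (hgk x).1 hxg
  ext k
  rw [← hx, ← hy]
  simp [Matrix.mulVec, dotProduct, hm]
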